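/- Simulation characterization for CTP node formulas: for every CTP node formula φ, every tree T, and every node n of T, one has T,n⊨φ if and only if there exists a simulation from the Boolean conditional tree pattern ct(φ) into the pointed tree (T.n, n). -/

import Mathlib

/- Trees over a label alphabet -/
structure RTree (A : Type) where
  Node : Type
  E : Node → Node → Prop
  root : Node
  label : Node → Set A

namespace RTree
variable {A : Type}

/-- Tree axioms not requiring finiteness of the node set: finite label sets,
    connectedness from the root, unique parents, acyclicity. -/
def IsPreTree (T : RTree A) : Prop :=
  (∀ n, (T.label n).Finite) ∧
  (∀ n, Relation.ReflTransGen T.E T.root n) ∧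
  (∀ n m m', T.E m n → T.E m' n → m = m') ∧
  (∀ n, ¬ Relation.TransGen T.E n n)

/-- A (finite, rooted, unranked) tree. -/
def IsTree (T : RTree A) : Prop := T.IsPreTree ∧ Finite T.Node

/-- Single-labeled (XML) trees: every node carries exactly one label. -/
def SingleLabeled (T : RTree A) : Prop := ∀ n, ∃ p, T.label n = {p}

end RTree

/- Conditional Tree Patterns: node formulas and path formulas.
   `cstar φ` is the conditional descendant path (↓;?φ)*;↓. -/
mutual
inductive CNF (A : Type) : Type where
  | lab : A → CNF A
  | top : CNF A
  | and : CNF A → CNF A → CNF A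
  | dia : CPF A → CNF A → CNF A
inductive CPF (A : Type) : Type where
  | child : CPF A
  | test : CNF A → CPF A
  | comp : CPF A → CPF A → CPF A
  | cstar : CNF A → CPF A
end

variable {A : Type}

mutual
/-- Satisfaction of CTP node formulas: the set of nodes where the formula holds. -/
def CNF.sat (T : RTree A) : CNF A → Set T.Node
  | .lab p => {n | p ∈ T.label n}
  | .top => Set.univ
  | .and φ ψ => {n | n ∈ CNF.sat T φ ∧ n ∈ CNF.sat T ψ}
  | .dia α φ => {n | ∃ m, CPF.sem T α n m ∧ m ∈ CNF.sat T φ}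
/-- Semantics of CTP path formulas: ⟦(↓;?φ)*;↓⟧ = (E∘⟦?φ⟧)*∘E. -/
def CPF.sem (T : RTree A) : CPF A → T.Node → T.Node → Prop
  | .child => T.E
  | .test φ => fun n m => n = m ∧ n ∈ CNF.sat T φ
  | .comp α β => fun n m => ∃ k, CPF.sem T α n k ∧ CPF.sem T β k m
  | .cstar φ => fun n m =>
      ∃ k, Relation.ReflTransGen (fun a b => T.E a b ∧ b ∈ CNF.sat T φ) n k ∧ T.E k m
end

/-- The subtree of `T` rooted at `n`. -/
def RTree.subtree (T : RTree A) (n : T.Node) : RTree A where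
  Node := {m : T.Node // Relation.ReflTransGen T.E n m}
  E a b := T.E a.1 b.1
  root := ⟨n, Relation.ReflTransGen.refl⟩
  label m := T.label m.1

/-- Boolean conditional tree patterns: a finite tree whose nodes carry a set of
labels, and whose edges carry either `none` (a child edge ↓) or `some t` with
`t` a Boolean conditional tree pattern (a conditional descendant edge).  The
sole output node of a Boolean pattern is its root. -/
inductive BPat (A : Type) : Type where
  | mk : Set A → List (Option (BPat A) × BPat A) → BPat A

/-- Conditional tree patterns with one output node: a Boolean pattern together
with a marked path from the root to the output node (the spine).  `here s ch`
is a pattern whose output node is its root; `step s ch el rest` is a pattern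
whose root has label set `s`, side subtrees `ch`, and one more edge labeled
`el` towards the subpattern `rest` containing the output node. -/
inductive OPat (A : Type) : Type where
  | here : Set A → List (Option (BPat A) × BPat A) → OPat A
  | step : Set A → List (Option (BPat A) × BPat A) → Option (BPat A) → OPat A → OPat A

mutual
/-- There exists a simulation from the Boolean pattern into the pointed tree
`(T, n)`: the root is mapped to `n`, labels are preserved, child edges are
mapped to child edges, and a conditional edge labeled by a Boolean pattern `c`
is mapped to a descendant edge all of whose intermediate nodes `z` admit a
simulation of `c` into the subtree `T.z`. -/
def SimB (T : RTree A) (p : BPat A) (n : T.Node) : Prop :=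
  match p with
  | .mk s ch => s ⊆ T.label n ∧ SimL T ch n
/-- Simulations for a list of outgoing (labeled) edges of a pattern node. -/
def SimL (T : RTree A) (l : List (Option (BPat A) × BPat A)) (n : T.Node) : Prop :=
  match l with
  | [] => True
  | (none, t) :: r => (∃ m, T.E n m ∧ SimB T t m) ∧ SimL T r n
  | (some c, t) :: r =>
      (∃ m, Relation.TransGen T.E n m ∧ SimB T t m ∧
        ∀ z, Relation.TransGen T.E n z → Relation.TransGen T.E z m →
          SimB (T.subtree z) c (T.subtree z).root) ∧ SimL T r n
end

mutual
/-- There exists a simulation from the one-output pattern into the pointed tree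
`(T, n)` mapping the output node to `out`. -/
def SimO (T : RTree A) (p : OPat A) (n out : T.Node) : Prop :=
  match p with
  | .here s ch => out = n ∧ s ⊆ T.label n ∧ SimL T ch n
  | .step s ch el rest =>
      s ⊆ T.label n ∧ SimL T ch n ∧
      match el with
      | none => ∃ m, T.E n m ∧ SimO T rest m out
      | some c =>
          ∃ m, Relation.TransGen T.E n m ∧ SimO T rest m out ∧
            ∀ z, Relation.TransGen T.E n z → Relation.TransGen T.E z m →
              SimB (T.subtree z) c (T.subtree z).root
end

/-- Fusion of two Boolean patterns at the root. -/
def BPat.fuse : BPat A → BPat A → BPat A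
  | .mk s ch, .mk s' ch' => .mk (s ∪ s') (ch ++ ch')

/-- Fuse a Boolean pattern onto the output node of a one-output pattern,
forgetting the output marking (the result is a Boolean pattern). -/
def OPat.graft : OPat A → BPat A → BPat A
  | .here s ch, .mk s' ch' => .mk (s ∪ s') (ch ++ ch')
  | .step s ch el rest, b => .mk s (ch ++ [(el, OPat.graft rest b)])

/-- Composition of one-output patterns: fuse the root of the second onto the
output node of the first; the output node of the second becomes the output. -/
def OPat.comp : OPat A → OPat A → OPat A
  | .here s ch, .here s' ch' => .here (s ∪ s') (ch ++ ch')
  | .here s ch, .step s' ch' el rest => .step (s ∪ s') (ch ++ ch') el rest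
  | .step s ch el rest, q => .step s ch el (OPat.comp rest q)

mutual
/-- The translation `ct` of CTP node formulas into Boolean conditional tree
patterns. -/
def ctN : CNF A → BPat A
  | .lab p => .mk {p} []
  | .top => .mk ∅ []
  | .and φ ψ => BPat.fuse (ctN φ) (ctN ψ)
  | .dia α φ => OPat.graft (ctP α) (ctN φ)
/-- The translation `ct` of CTP path formulas into conditional tree patterns
with one output node. -/
def ctP : CPF A → OPat A
  | .child => .step ∅ [] none (.here ∅ [])
  | .test φ =>
      match ctN φ with
      | .mk s ch => .here s ch
  | .comp α β => OPat.comp (ctP α) (ctP β)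
  | .cstar φ => .step ∅ [] (some (ctN φ)) (.here ∅ [])
end

theorem tg_sub (T : RTree A) (n : T.Node) (x y : (T.subtree n).Node) :
    Relation.TransGen (T.subtree n).E x y ↔ Relation.TransGen T.E x.1 y.1 := by
  constructor
  · intro h
    induction h with
    | single h => exact .single h
    | tail _ h ih => exact ih.tail h
  · obtain ⟨y, hy⟩ := y
    intro h
    dsimp only at h
    induction h with
    | single h => exact .single h
    | @tail b c hb h ih =>
      exact Relation.TransGen.tail (b := (⟨b, x.2.trans hb.to_reflTransGen⟩ : (T.subtree n).Node))
        (ih _) h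

mutual
theorem simB_sub (p : BPat A) (T : RTree A) (n : T.Node) (x : (T.subtree n).Node) :
    SimB (T.subtree n) p x ↔ SimB T p x.1 := by
  match p with
  | .mk s ch =>
    have := simL_sub ch T n x
    simp only [SimB, this]
    rfl
theorem simL_sub (l : List (Option (BPat A) × BPat A)) (T : RTree A) (n : T.Node)
    (x : (T.subtree n).Node) :
    SimL (T.subtree n) l x ↔ SimL T l x.1 := by
  match l with
  | [] => simp only [SimL]
  | (none, t) :: r =>
    have h1 := simL_sub r T n x
    have h2 := simB_sub t T n
    simp only [SimL, h1, h2]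
    refine and_congr_left fun _ => ⟨?_, ?_⟩
    · rintro ⟨m, hm, h⟩
      exact ⟨m.1, hm, h⟩
    · rintro ⟨m, hm, h⟩
      exact ⟨⟨m, x.2.tail hm⟩, hm, h⟩
  | (some c, t) :: r =>
    have h1 := simL_sub r T n x
    have h2 := simB_sub t T n
    have h3 := simB_sub c
    simp only [SimL, h1, h2, h3, tg_sub]
    refine and_congr_left fun _ => ⟨?_, ?_⟩
    · rintro ⟨m, hm, h, h'⟩
      exact ⟨m.1, hm, h, fun z hz hz' => h' ⟨z, x.2.trans hz.to_reflTransGen⟩ hz hz'⟩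
    · rintro ⟨m, hm, h, h'⟩
      exact ⟨⟨m, x.2.trans hm.to_reflTransGen⟩, hm, h, fun z hz hz' => h' z.1 hz hz'⟩
end

theorem simL_append (T : RTree A) (l r : List (Option (BPat A) × BPat A)) (n : T.Node) :
    SimL T (l ++ r) n ↔ SimL T l n ∧ SimL T r n := by
  induction l with
  | nil => simp [SimL]
  | cons a l ih =>
    obtain ⟨_ | c, t⟩ := a <;> simp only [List.cons_append, SimL, ih, and_assoc]

theorem simB_fuse (T : RTree A) (p q : BPat A) (n : T.Node) :
    SimB T (p.fuse q) n ↔ SimB T p n ∧ SimB T q n := by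
  obtain ⟨s, ch⟩ := p
  obtain ⟨s', ch'⟩ := q
  simp only [BPat.fuse, SimB, simL_append, Set.union_subset_iff]
  tauto

theorem simB_graft (T : RTree A) (p : OPat A) (q : BPat A) (n : T.Node) :
    SimB T (p.graft q) n ↔ ∃ k, SimO T p n k ∧ SimB T q k := by
  induction p generalizing n with
  | here s ch =>
    obtain ⟨s', ch'⟩ := q
    simp only [OPat.graft, SimB, SimO, simL_append, Set.union_subset_iff]
    constructor
    · rintro ⟨⟨a, b⟩, c, d⟩
      exact ⟨n, ⟨rfl, a, c⟩, b, d⟩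
    · rintro ⟨_, ⟨rfl, a, c⟩, b, d⟩
      exact ⟨⟨a, b⟩, c, d⟩
  | step s ch el rest ih =>
    cases el with
    | none =>
      simp only [OPat.graft, SimB, SimO, simL_append, SimL, ih]
      grind
    | some c =>
      simp only [OPat.graft, SimB, SimO, simL_append, SimL, ih]
      constructor
      · rintro ⟨a, b, ⟨m, h1, ⟨k, h2, h3⟩, h4⟩, -⟩
        exact ⟨k, ⟨a, b, m, h1, h2, h4⟩, h3⟩
      · rintro ⟨k, ⟨a, b, m, h1, h2, h4⟩, h3⟩
        exact ⟨a, b, ⟨m, h1, ⟨k, h2, h3⟩, h4⟩, trivial⟩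

theorem simO_comp (T : RTree A) (p q : OPat A) (n m : T.Node) :
    SimO T (p.comp q) n m ↔ ∃ k, SimO T p n k ∧ SimO T q k m := by
  induction p generalizing n with
  | here s ch =>
    cases q with
    | here s' ch' =>
      simp only [OPat.comp, SimO, simL_append, Set.union_subset_iff]
      constructor
      · rintro ⟨rfl, ⟨a, b⟩, c, d⟩
        exact ⟨m, ⟨rfl, a, c⟩, rfl, b, d⟩
      · rintro ⟨_, ⟨rfl, a, c⟩, rfl, b, d⟩
        exact ⟨rfl, ⟨a, b⟩, c, d⟩
    | step s' ch' el rest =>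
      simp only [OPat.comp, SimO, simL_append, Set.union_subset_iff]
      constructor
      · rintro ⟨⟨a, b⟩, ⟨c, d⟩, e⟩
        exact ⟨n, ⟨rfl, a, c⟩, b, d, e⟩
      · rintro ⟨_, ⟨rfl, a, c⟩, b, d, e⟩
        exact ⟨⟨a, b⟩, ⟨c, d⟩, e⟩
  | step s ch el rest ih =>
    cases el with
    | none =>
      simp only [OPat.comp, SimO, ih]
      grind
    | some c =>
      simp only [OPat.comp, SimO, ih]
      constructor
      · rintro ⟨a, b, m, h1, ⟨k, h2, h3⟩, h4⟩
        exact ⟨k, ⟨a, b, m, h1, h2, h4⟩, h3⟩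
      · rintro ⟨k, ⟨a, b, m, h1, h2, h4⟩, h3⟩
        exact ⟨a, b, m, h1, ⟨k, h2, h3⟩, h4⟩

theorem cstar_iff {N : Type} (E : N → N → Prop) (hu : ∀ n m m', E m n → E m' n → m = m')
    (ha : ∀ n, ¬ Relation.TransGen E n n) (P : N → Prop) (n m : N) :
    (∃ k, Relation.ReflTransGen (fun a b => E a b ∧ P b) n k ∧ E k m) ↔
      Relation.TransGen E n m ∧
        ∀ z, Relation.TransGen E n z → Relation.TransGen E z m → P z := by
  constructor
  · rintro ⟨k, hk, hm⟩
    refine ⟨Relation.TransGen.tail' (Relation.ReflTransGen.mono (fun _ _ h => h.1) _ _ hk) hm, ?_⟩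
    induction hk generalizing m with
    | refl =>
      intro z hz hz'
      obtain ⟨w, hw, hw'⟩ := Relation.TransGen.tail'_iff.1 hz'
      obtain rfl := hu _ _ _ hm hw'
      exact absurd (hz.trans_left hw) (ha _)
    | @tail b c _ hbc ih =>
      intro z hz hz'
      obtain ⟨w, hw, hw'⟩ := Relation.TransGen.tail'_iff.1 hz'
      obtain rfl := hu _ _ _ hm hw'
      rcases Relation.reflTransGen_iff_eq_or_transGen.1 hw with h | h
      · subst h
        exact hbc.2
      · exact ih _ hbc.1 z hz h
  · rintro ⟨h, hP⟩
    induction h with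
    | single h => exact ⟨n, .refl, h⟩
    | @tail b c hb hbc ih =>
      obtain ⟨k, hk, hkb⟩ := ih fun z hz hz' => hP z hz (hz'.tail hbc)
      exact ⟨b, hk.tail ⟨hkb, hP b hb (.single hbc)⟩, hbc⟩

mutual
theorem sat_iff (T : RTree A) (hT : T.IsTree) (φ : CNF A) (n : T.Node) :
    n ∈ CNF.sat T φ ↔ SimB T (ctN φ) n := by
  match φ with
  | .lab p => simp [CNF.sat, ctN, SimB, SimL]
  | .top => simp [CNF.sat, ctN, SimB, SimL]
  | .and φ ψ =>
    have h1 := sat_iff T hT φ n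
    have h2 := sat_iff T hT ψ n
    simp only [CNF.sat, ctN, simB_fuse, ← h1, ← h2, Set.mem_ofPred_eq]
  | .dia α φ =>
    have h1 := sem_iff T hT α n
    have h2 := sat_iff T hT φ
    simp only [CNF.sat, ctN, simB_graft, ← h1, ← h2, Set.mem_ofPred_eq]
theorem sem_iff (T : RTree A) (hT : T.IsTree) (α : CPF A) (n m : T.Node) :
    CPF.sem T α n m ↔ SimO T (ctP α) n m := by
  match α with
  | .child => simp [CPF.sem, ctP, SimO, SimL]
  | .test φ =>
    have h1 := sat_iff T hT φ n
    simp only [CPF.sem, ctP, h1]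
    cases ctN φ with
    | mk s ch => simp only [SimO, SimB, eq_comm]
  | .comp α β =>
    have h1 := sem_iff T hT α
    have h2 := sem_iff T hT β
    simp only [CPF.sem, ctP, simO_comp, ← h1, ← h2]
  | .cstar φ =>
    have h1 := sat_iff T hT φ
    have h2 := cstar_iff T.E hT.1.2.2.1 hT.1.2.2.2 (fun z => z ∈ CNF.sat T φ) n m
    simp only [CPF.sem, ctP, SimO, SimL, simB_sub, h1] at h2 ⊢
    simp [RTree.subtree]
    exact h2
end

/-- Simulation characterization for CTP node formulas: a CTP node
formula φ holds at a node n of a tree T iff there is a simulation from the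
Boolean conditional tree pattern ct(φ) into the pointed tree (T.n, n). -/
theorem ctp_node_simulation (T : RTree A) (hT : T.IsTree)
    (φ : CNF A) (n : T.Node) :
    n ∈ CNF.sat T φ ↔ SimB (T.subtree n) (ctN φ) (T.subtree n).root := by
  rw [simB_sub]
  exact sat_iff T hT φ n
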